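/- arXiv:2501.16690 — 2 statements merged into one kernel-verified Lean document; each statement's English description precedes it below -/
import Mathlib

section
/- Within each column of the Mermin–Peres square, the three entries pairwise commute: for every j ∈ {1,2,3} and every k, k' ∈ {1,2,3}, the matrices M_{k,j} and M_{k',j} satisfy M_{k,j}·M_{k',j} = M_{k',j}·M_{k,j}. -/
open Matrix Kronecker

/-- The Pauli matrix `σ₀` (the 2×2 identity). -/
noncomputable def pauli0 : Matrix (Fin 2) (Fin 2) ℂ := 1

/-- The Pauli matrix `σ_x`. -/
noncomputable def pauliX : Matrix (Fin 2) (Fin 2) ℂ := !![0, 1; 1, 0]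

/-- The Pauli matrix `σ_y`. -/
noncomputable def pauliY : Matrix (Fin 2) (Fin 2) ℂ := !![0, -Complex.I; Complex.I, 0]

/-- The Pauli matrix `σ_z`. -/
noncomputable def pauliZ : Matrix (Fin 2) (Fin 2) ℂ := !![1, 0; 0, -1]

/-- The Mermin–Peres square: a 3×3 array of 4×4 complex matrices (acting on
`ℂ² ⊗ ℂ²`, whose index type `Fin 2 × Fin 2` is identified with `Fin 4`
lexicographically), built from the Pauli matrices via the Kronecker product. -/
noncomputable def MP : Fin 3 → Fin 3 → Matrix (Fin 2 × Fin 2) (Fin 2 × Fin 2) ℂ :=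
  ![![pauli0 ⊗ₖ pauliZ, pauliZ ⊗ₖ pauli0, pauliZ ⊗ₖ pauliZ],
    ![pauliX ⊗ₖ pauli0, pauli0 ⊗ₖ pauliX, pauliX ⊗ₖ pauliX],
    ![-(pauliX ⊗ₖ pauliZ), -(pauliZ ⊗ₖ pauliX), pauliY ⊗ₖ pauliY]]

lemma pauliZ_mul_pauliX : pauliZ * pauliX = -(pauliX * pauliZ) := by
  simp [pauliX, pauliZ]

lemma pauliY_mul_pauliX : pauliY * pauliX = -(pauliX * pauliY) := by
  simp [pauliX, pauliY]

lemma pauliZ_mul_pauliY : pauliZ * pauliY = -(pauliY * pauliZ) := by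
  simp [pauliY, pauliZ]

/-- Negating both factors leaves a Kronecker product unchanged. -/
lemma neg_kronecker_neg {l m n p R : Type*} [Ring R] (A : Matrix l m R) (B : Matrix n p R) :
    (-A) ⊗ₖ (-B) = A ⊗ₖ B := by
  ext
  simp

/-- Within each column of the Mermin–Peres square, the three
entries pairwise commute. -/
theorem stmt_10 (j k k' : Fin 3) : MP k j * MP k' j = MP k' j * MP k j := by
  fin_cases j <;> fin_cases k <;> fin_cases k' <;>
    simp [MP, pauli0, ← mul_kronecker_mul, pauliZ_mul_pauliX, pauliY_mul_pauliX,
      pauliZ_mul_pauliY, neg_kronecker_neg]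
end

section
/- For every column j ∈ {1,2,3} of the Mermin–Peres square, the product of the three entries of that column equals the negative of the 4×4 identity matrix: M_{1,j}·M_{2,j}·M_{3,j} = −I₄. -/
open Matrix Kronecker

lemma pauliX_mul_pauliX : pauliX * pauliX = 1 := by
  simp [pauliX, Matrix.one_fin_two]

lemma pauliZ_mul_pauliZ : pauliZ * pauliZ = 1 := by
  simp [pauliZ, Matrix.one_fin_two]

lemma pauliZ_mul_pauliX_mul_pauliY :
    pauliZ * pauliX * pauliY = Complex.I • (1 : Matrix (Fin 2) (Fin 2) ℂ) := by
  simp [pauliX, pauliY, pauliZ, Matrix.one_fin_two]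

/-- The product of the three entries of each column of the
Mermin–Peres square equals the negative of the identity matrix. -/
theorem stmt_12 (j : Fin 3) : MP 0 j * MP 1 j * MP 2 j = -1 := by
  fin_cases j
  · change pauli0 ⊗ₖ pauliZ * pauliX ⊗ₖ pauli0 * -(pauliX ⊗ₖ pauliZ) = -1
    simp only [pauli0, mul_neg, ← mul_kronecker_mul, one_mul, mul_one, pauliX_mul_pauliX,
      pauliZ_mul_pauliZ, one_kronecker_one]
  · change pauliZ ⊗ₖ pauli0 * pauli0 ⊗ₖ pauliX * -(pauliZ ⊗ₖ pauliX) = -1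
    simp only [pauli0, mul_neg, ← mul_kronecker_mul, one_mul, mul_one, pauliX_mul_pauliX,
      pauliZ_mul_pauliZ, one_kronecker_one]
  · change pauliZ ⊗ₖ pauliZ * pauliX ⊗ₖ pauliX * pauliY ⊗ₖ pauliY = -1
    rw [← mul_kronecker_mul, ← mul_kronecker_mul, pauliZ_mul_pauliX_mul_pauliY,
      smul_kronecker, kronecker_smul, one_kronecker_one, smul_smul, Complex.I_mul_I, neg_one_smul]
end
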